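/- Define ν̃(θ) = (c₀/(π·sin c₀))·F_∞(θ)·F_∞(π−θ) for θ ∈ [0,π], and for a continuously differentiable φ : [0,π] → ℝ set (Lφ)(θ) = φ′(θ) + ∫₀^θ 2·F(θ−α)·(F_∞(α)/F_∞(θ))·(φ(α) − φ(θ)) dα for θ ∈ (0,π). Then: (i) ν̃(θ) ≥ 0 for all θ ∈ [0,π]; (ii) ∫₀^π ν̃(θ) dθ = 1; and (iii) for every continuously differentiable φ : [0,π] → ℝ with φ(0) = φ(π) = 0, ∫₀^π ν̃(θ)·(Lφ)(θ) dθ = 0. (Proposition 4.3 of the paper: ν̃ is the stationary probability density of the continuous-time angle process along the spine.) -/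

import Mathlib

open MeasureTheory Real

noncomputable def J0 (x : ℝ) : ℝ :=
  ∑' k : ℕ, (-1 : ℝ) ^ k * (x / 2) ^ (2 * k) / ((Nat.factorial k : ℝ)) ^ 2

noncomputable def J1 (x : ℝ) : ℝ :=
  ∑' k : ℕ, (-1 : ℝ) ^ k * (x / 2) ^ (2 * k + 1) /
    ((Nat.factorial k : ℝ) * (Nat.factorial (k + 1) : ℝ))

noncomputable def c0 : ℝ := sInf {x : ℝ | 0 < x ∧ J0 x = 0}

/-- `F_∞(θ) = J₀(θ c₀/π)`. -/
noncomputable def Finf (θ : ℝ) : ℝ := J0 (θ * c0 / Real.pi)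

/-- The critical generating function `F(x_c; θ) = c₀ J₁(θ c₀/π)/(2πθ)`, with
`F(0) = (c₀/(2π))²`. -/
noncomputable def F (θ : ℝ) : ℝ :=
  if θ = 0 then (c0 / (2 * Real.pi)) ^ 2
  else c0 * J1 (θ * c0 / Real.pi) / (2 * Real.pi * θ)

/-- The stationary density `ν̃(θ) = (c₀/(π sin c₀)) F_∞(θ) F_∞(π−θ)`. -/
noncomputable def nuTilde (θ : ℝ) : ℝ :=
  c0 / (Real.pi * Real.sin c0) * Finf θ * Finf (Real.pi - θ)

/-- The generator of the continuous-time angle process along the spine: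
`(Lφ)(θ) = φ′(θ) + ∫₀^θ 2 F(θ−α) (F_∞(α)/F_∞(θ)) (φ(α) − φ(θ)) dα`. -/
noncomputable def Lgen (φ : ℝ → ℝ) (θ : ℝ) : ℝ :=
  deriv φ θ + ∫ α in (0:ℝ)..θ, 2 * F (θ - α) * (Finf α / Finf θ) * (φ α - φ θ)

section Bessel

open Finset.HasAntidiagonal (antidiagonal mem_antidiagonal)

/-! ### Binomial convolutions -/

theorem sum_antidiagonal_centralBinom_mul (n : ℕ) :
    ∑ p ∈ antidiagonal n, (p.1.centralBinom : ℝ) * p.2.centralBinom = 4 ^ n := by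
  induction n with
  | zero => simp
  | succ n ih =>
    have hrec (k : ℕ) :
        ((k : ℝ) + 1) * (k + 1).centralBinom = 2 * (2 * k + 1) * k.centralBinom := by
      exact_mod_cast Nat.succ_mul_centralBinom_succ k
    have hsym (m : ℕ) : ∑ p ∈ antidiagonal m,
        (p.1 : ℝ) * (p.1.centralBinom * p.2.centralBinom) =
        ∑ p ∈ antidiagonal m, (p.2 : ℝ) * (p.1.centralBinom * p.2.centralBinom) := by
      rw [← Finset.Nat.sum_antidiagonal_swap]
      exact Finset.sum_congr rfl fun p _ => by simp [mul_comm]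
    have hhalf (m : ℕ) : 2 * ∑ p ∈ antidiagonal m,
        (p.1 : ℝ) * (p.1.centralBinom * p.2.centralBinom) =
        m * ∑ p ∈ antidiagonal m, (p.1.centralBinom : ℝ) * p.2.centralBinom := by
      rw [two_mul]
      nth_rw 2 [hsym]
      rw [← Finset.sum_add_distrib, Finset.mul_sum]
      refine Finset.sum_congr rfl fun p hp => ?_
      rw [← mem_antidiagonal.mp hp]
      push_cast
      ring
    have h1 := hhalf (n + 1)
    rw [Finset.Nat.sum_antidiagonal_succ
      (f := fun p : ℕ × ℕ => (p.1 : ℝ) * (p.1.centralBinom * p.2.centralBinom))] at h1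
    have h2 : ∑ p ∈ antidiagonal n,
        (((p.1 + 1 : ℕ) : ℝ) * ((p.1 + 1).centralBinom * p.2.centralBinom)) =
        4 * (∑ p ∈ antidiagonal n, (p.1 : ℝ) * (p.1.centralBinom * p.2.centralBinom)) +
        2 * ∑ p ∈ antidiagonal n, (p.1.centralBinom : ℝ) * p.2.centralBinom := by
      rw [Finset.mul_sum, Finset.mul_sum, ← Finset.sum_add_distrib]
      refine Finset.sum_congr rfl fun p _ => ?_
      push_cast
      rw [← mul_assoc, hrec]
      ring
    have h3 := hhalf n
    rw [h2] at h1
    rw [ih] at h1 h3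
    have hn : (n : ℝ) + 1 ≠ 0 := by positivity
    apply mul_left_cancel₀ hn
    push_cast at h1
    rw [pow_succ]
    linarith

theorem catalan_cast_eq (n : ℕ) :
    (catalan n : ℝ) = 2 * n.centralBinom - (n + 1).centralBinom / 2 := by
  have hn : (n : ℝ) + 1 ≠ 0 := by positivity
  have h1 : ((n : ℝ) + 1) * (n + 1).centralBinom = 2 * (2 * n + 1) * n.centralBinom := by
    exact_mod_cast Nat.succ_mul_centralBinom_succ n
  have h2 : ((n : ℝ) + 1) * catalan n = n.centralBinom := by
    exact_mod_cast succ_mul_catalan_eq_centralBinom n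
  apply mul_left_cancel₀ hn
  linear_combination h2 + h1 / 2

theorem sum_antidiagonal_centralBinom_mul_catalan (n : ℕ) :
    ∑ p ∈ antidiagonal n, (p.1.centralBinom : ℝ) * catalan p.2 =
      (n + 1).centralBinom / 2 := by
  have h := sum_antidiagonal_centralBinom_mul (n + 1)
  rw [Finset.Nat.sum_antidiagonal_succ'
      (f := fun p : ℕ × ℕ => (p.1.centralBinom : ℝ) * p.2.centralBinom)] at h
  have h1 : ∑ p ∈ antidiagonal n, (p.1.centralBinom : ℝ) * catalan p.2 =
      2 * (∑ p ∈ antidiagonal n, (p.1.centralBinom : ℝ) * p.2.centralBinom) -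
      (∑ p ∈ antidiagonal n, (p.1.centralBinom : ℝ) * (p.2 + 1).centralBinom) / 2 := by
    rw [Finset.mul_sum, Finset.sum_div, ← Finset.sum_sub_distrib]
    exact Finset.sum_congr rfl fun p _ => by rw [catalan_cast_eq]; ring
  rw [h1, sum_antidiagonal_centralBinom_mul]
  simp only [Nat.centralBinom_zero, pow_succ] at h
  push_cast at h
  linarith

/-! ### Even exponential series and their convolution -/

/-- The even series `∑ aₙ x²ⁿ/(2n)!`. -/
noncomputable def evenSeries (a : ℕ → ℝ) (x : ℝ) : ℝ :=
  ∑' n, a n * x ^ (2 * n) / (2 * n).factorial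

theorem summable_even_pow_div_factorial (x : ℝ) :
    Summable fun n : ℕ => |x| ^ (2 * n) / ((2 * n).factorial : ℝ) :=
  (Real.summable_pow_div_factorial |x|).comp_injective
    (mul_right_injective₀ (two_ne_zero : (2 : ℕ) ≠ 0))

theorem abs_evenSeries_term_le {a : ℕ → ℝ} (ha : ∀ n, |a n| ≤ 1) {x y : ℝ} (h : |x| ≤ |y|)
    (n : ℕ) :
    ‖a n * x ^ (2 * n) / (2 * n).factorial‖ ≤ |y| ^ (2 * n) / ((2 * n).factorial : ℝ) := by
  rw [Real.norm_eq_abs, abs_div, abs_mul, abs_pow, Nat.abs_cast]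
  gcongr
  calc |a n| * |x| ^ (2 * n) ≤ 1 * |y| ^ (2 * n) := by gcongr; exact ha n
    _ = _ := one_mul _

theorem summable_norm_evenSeries {a : ℕ → ℝ} (ha : ∀ n, |a n| ≤ 1) (x : ℝ) :
    Summable fun n => ‖a n * x ^ (2 * n) / (2 * n).factorial‖ :=
  (summable_even_pow_div_factorial x).of_nonneg_of_le (fun _ => norm_nonneg _)
    (abs_evenSeries_term_le ha le_rfl)

theorem continuous_evenSeries {a : ℕ → ℝ} (ha : ∀ n, |a n| ≤ 1) :
    Continuous (evenSeries a) := by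
  rw [continuous_iff_continuousAt]
  intro x
  have hx : Metric.ball (0 : ℝ) (|x| + 1) ∈ nhds x :=
    Metric.isOpen_ball.mem_nhds (by simp)
  refine ContinuousOn.continuousAt ?_ hx
  refine continuousOn_tsum (u := fun n : ℕ => |(|x| + 1)| ^ (2 * n) / ((2 * n).factorial : ℝ))
    (fun n => by fun_prop) (summable_even_pow_div_factorial _) fun n y hy => ?_
  refine abs_evenSeries_term_le ha ?_ n
  rw [abs_of_nonneg (by positivity : (0 : ℝ) ≤ |x| + 1)]
  simpa using (Metric.mem_ball.mp hy).le

theorem integral_pow_mul_sub_pow (x : ℝ) (m n : ℕ) :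
    ∫ s in (0 : ℝ)..x, s ^ m * (x - s) ^ n =
      m.factorial * n.factorial / (m + n + 1).factorial * x ^ (m + n + 1) := by
  induction n generalizing m with
  | zero =>
    simp only [pow_zero, mul_one, integral_pow]
    rw [add_zero, Nat.factorial_succ]
    have := Nat.factorial_ne_zero m
    push_cast
    field_simp
    simp
  | succ n ih =>
    have hm : (m : ℝ) + 1 ≠ 0 := by positivity
    have h := intervalIntegral.integral_mul_deriv_eq_deriv_mul (a := 0) (b := x)
      (u := fun s => (x - s) ^ (n + 1)) (v := fun s => s ^ (m + 1) / (m + 1))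
      (u' := fun s => -((n + 1) * (x - s) ^ n)) (v' := fun s => s ^ m)
      (fun s _ => by
        refine (((hasDerivAt_id s).const_sub x).fun_pow (n + 1)).congr_deriv ?_
        simp)
      (fun s _ => by
        convert (hasDerivAt_pow (m + 1) s).div_const ((m : ℝ) + 1) using 1
        push_cast
        field_simp)
      (Continuous.intervalIntegrable (by fun_prop) _ _)
      (Continuous.intervalIntegrable (by fun_prop) _ _)
    have h1 : ∫ s in (0 : ℝ)..x, s ^ m * (x - s) ^ (n + 1) =
        ∫ s in (0 : ℝ)..x, (x - s) ^ (n + 1) * s ^ m :=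
      intervalIntegral.integral_congr fun s _ => mul_comm _ _
    have h2 : ∫ s in (0 : ℝ)..x, -((n + 1) * (x - s) ^ n) * (s ^ (m + 1) / (m + 1)) =
        -((n + 1) / (m + 1)) * ∫ s in (0 : ℝ)..x, s ^ (m + 1) * (x - s) ^ n := by
      rw [← intervalIntegral.integral_const_mul]
      exact intervalIntegral.integral_congr fun s _ => by ring
    rw [h1, h, h2, ih]
    have e : m + 1 + n + 1 = m + (n + 1) + 1 := by ring
    rw [e, Nat.factorial_succ m, Nat.factorial_succ n]
    push_cast
    have := Nat.factorial_ne_zero (m + (n + 1) + 1)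
    simp
    field_simp

theorem integral_evenSeries_term_mul (u v x : ℝ) (k l : ℕ) :
    ∫ s in (0 : ℝ)..x, (u * s ^ (2 * k) / (2 * k).factorial) *
        (v * (x - s) ^ (2 * l) / (2 * l).factorial) =
      u * v * x ^ (2 * (k + l) + 1) / (2 * (k + l) + 1).factorial := by
  have h1 : ∀ s : ℝ, (u * s ^ (2 * k) / (2 * k).factorial) *
        (v * (x - s) ^ (2 * l) / (2 * l).factorial) =
      (u * v / ((2 * k).factorial * (2 * l).factorial)) *
        (s ^ (2 * k) * (x - s) ^ (2 * l)) := fun s => by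
    rw [div_mul_div_comm, div_mul_eq_mul_div]
    ring
  simp_rw [h1]
  rw [intervalIntegral.integral_const_mul, integral_pow_mul_sub_pow, ← mul_add]
  have hk : ((2 * k).factorial : ℝ) ≠ 0 := by positivity
  have hl : ((2 * l).factorial : ℝ) ≠ 0 := by positivity
  have hkl : ((2 * (k + l) + 1).factorial : ℝ) ≠ 0 := by positivity
  generalize ((2 * k).factorial : ℝ) = A at *
  generalize ((2 * l).factorial : ℝ) = B at *
  generalize ((2 * (k + l) + 1).factorial : ℝ) = C at *
  field_simp

theorem intervalIntegral_tsum_mul_tsum {f g : ℕ → ℝ → ℝ} {u v : ℕ → ℝ} {x y : ℝ}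
    (hf : ∀ n, Continuous (f n)) (hg : ∀ n, Continuous (g n))
    (hfu : ∀ n, ∀ s ∈ Set.uIoc x y, ‖f n s‖ ≤ u n) (hgv : ∀ n, ∀ s ∈ Set.uIoc x y, ‖g n s‖ ≤ v n)
    (hu : Summable u) (hv : Summable v) (hu0 : ∀ n, 0 ≤ u n) (hv0 : ∀ n, 0 ≤ v n) :
    ∫ s in x..y, (∑' n, f n s) * ∑' n, g n s =
      ∑' n, ∑ p ∈ antidiagonal n, ∫ s in x..y, f p.1 s * g p.2 s := by
  have key := intervalIntegral.hasSum_integral_of_dominated_convergence (μ := volume)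
    (a := x) (b := y)
    (F := fun n s => ∑ p ∈ antidiagonal n, f p.1 s * g p.2 s)
    (f := fun s => (∑' n, f n s) * ∑' n, g n s)
    (fun n _ => ∑ p ∈ antidiagonal n, u p.1 * v p.2)
    (fun n => Continuous.aestronglyMeasurable (by fun_prop))
    (fun n => Filter.Eventually.of_forall fun s hs => by
      refine (norm_sum_le _ _).trans (Finset.sum_le_sum fun p _ => ?_)
      rw [norm_mul]
      exact mul_le_mul (hfu _ s hs) (hgv _ s hs) (norm_nonneg _) (hu0 _))
    (Filter.Eventually.of_forall fun s _ =>
      summable_sum_mul_antidiagonal_of_summable_mul (hu.mul_of_nonneg hv hu0 hv0))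
    (by simp)
    (Filter.Eventually.of_forall fun s hs => by
      have h1 : Summable fun n => ‖f n s‖ :=
        hu.of_nonneg_of_le (fun _ => norm_nonneg _) fun n => hfu n s hs
      have h2 : Summable fun n => ‖g n s‖ :=
        hv.of_nonneg_of_le (fun _ => norm_nonneg _) fun n => hgv n s hs
      rw [tsum_mul_tsum_eq_tsum_sum_antidiagonal_of_summable_norm h1 h2]
      exact (summable_norm_sum_mul_antidiagonal_of_summable_norm h1 h2).of_norm.hasSum)
  rw [← key.tsum_eq]
  exact tsum_congr fun n => intervalIntegral.integral_finsetSum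
    fun p _ => Continuous.intervalIntegrable (by fun_prop) _ _

theorem integral_evenSeries_mul_evenSeries_sub {a b : ℕ → ℝ} (ha : ∀ n, |a n| ≤ 1)
    (hb : ∀ n, |b n| ≤ 1) (x : ℝ) :
    ∫ s in (0 : ℝ)..x, evenSeries a s * evenSeries b (x - s) =
      ∑' n, (∑ p ∈ antidiagonal n, a p.1 * b p.2) * x ^ (2 * n + 1) /
        (2 * n + 1).factorial := by
  have habs {s : ℝ} (hs : s ∈ Set.uIoc 0 x) : |s| ≤ |x| ∧ |x - s| ≤ |x| := by
    have h := Set.uIoc_subset_uIcc hs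
    exact ⟨by simpa using Set.abs_sub_left_of_mem_uIcc h,
      by simpa using Set.abs_sub_right_of_mem_uIcc h⟩
  have h := intervalIntegral_tsum_mul_tsum (x := 0) (y := x)
    (f := fun n s => a n * s ^ (2 * n) / (2 * n).factorial)
    (g := fun n s => b n * (x - s) ^ (2 * n) / (2 * n).factorial)
    (fun n => by fun_prop) (fun n => by fun_prop)
    (fun n s hs => abs_evenSeries_term_le ha (habs hs).1 n)
    (fun n s hs => abs_evenSeries_term_le hb (habs hs).2 n)
    (summable_even_pow_div_factorial x) (summable_even_pow_div_factorial x)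
    (fun n => by positivity) (fun n => by positivity)
  refine h.trans (tsum_congr fun n => ?_)
  rw [Finset.sum_mul, Finset.sum_div]
  refine Finset.sum_congr rfl fun p hp => ?_
  rw [integral_evenSeries_term_mul, mem_antidiagonal.mp hp]

/-- Termwise differentiation of an even exponential series. -/
theorem hasDerivAt_evenSeries {a : ℕ → ℝ} (ha : ∀ n, |a n| ≤ 1) (x : ℝ) :
    HasDerivAt (evenSeries a)
      (∑' n, a (n + 1) * x ^ (2 * n + 1) / (2 * n + 1).factorial) x := by
  have hodd : Summable fun n : ℕ => (|x| + 1) ^ (2 * n + 1) / ((2 * n + 1).factorial : ℝ) :=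
    (Real.summable_pow_div_factorial (|x| + 1)).comp_injective
      fun m n h => by simpa using h
  have hsplit : evenSeries a = fun y => a 0 +
      ∑' n, a (n + 1) * y ^ (2 * (n + 1)) / (2 * (n + 1)).factorial := by
    funext y
    unfold evenSeries
    rw [(summable_norm_evenSeries ha y).of_norm.tsum_eq_zero_add]
    simp
  rw [hsplit]
  refine HasDerivAt.const_add _ ?_
  refine hasDerivAt_tsum_of_isPreconnected
    (g := fun n y => a (n + 1) * y ^ (2 * (n + 1)) / (2 * (n + 1)).factorial)
    (g' := fun n y => a (n + 1) * y ^ (2 * n + 1) / (2 * n + 1).factorial)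
    (t := Metric.ball (0 : ℝ) (|x| + 1)) (y₀ := 0) (y := x) hodd
    Metric.isOpen_ball (convex_ball _ _).isPreconnected (fun n y _ => ?_) (fun n y hy => ?_)
    (Metric.mem_ball_self (by positivity)) ?_ (by simp)
  · refine (((hasDerivAt_pow (2 * (n + 1)) y).const_mul (a (n + 1))).div_const _).congr_deriv ?_
    have h1 : (2 * (n + 1)).factorial = (2 * n + 2) * (2 * n + 1).factorial :=
      Nat.factorial_succ (2 * n + 1)
    have h2 : 2 * (n + 1) - 1 = 2 * n + 1 := by omega
    have h3 : ((2 * n + 1).factorial : ℝ) ≠ 0 := by positivity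
    have h4 : (n : ℝ) + 1 ≠ 0 := by positivity
    rw [h1, h2]
    push_cast
    generalize ((2 * n + 1).factorial : ℝ) = A at *
    field_simp
  · have hy' : |y| ≤ |x| + 1 := by simpa using (Metric.mem_ball.mp hy).le
    rw [Real.norm_eq_abs, abs_div, abs_mul, abs_pow, Nat.abs_cast]
    gcongr
    calc |a (n + 1)| * |y| ^ (2 * n + 1) ≤ 1 * (|x| + 1) ^ (2 * n + 1) := by gcongr; exact ha _
      _ = _ := one_mul _
  · exact ((summable_norm_evenSeries ha 0).of_norm.comp_injective (add_left_injective 1))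

/-! ### The Bessel functions as even exponential series -/

/-- Coefficients of `J₀` as an even exponential series. -/
noncomputable def besselZeroCoeff (n : ℕ) : ℝ := (-1) ^ n * n.centralBinom / 4 ^ n

/-- Coefficients of `x ↦ J₁(x)/x` as an even exponential series. -/
noncomputable def besselOneDivCoeff (n : ℕ) : ℝ := (-1) ^ n * catalan n / (2 * 4 ^ n)

theorem abs_besselZeroCoeff_le (n : ℕ) : |besselZeroCoeff n| ≤ 1 := by
  have h : (n.centralBinom : ℝ) ≤ 4 ^ n := by exact_mod_cast Nat.centralBinom_le_four_pow n
  rw [besselZeroCoeff, abs_div, abs_mul, abs_pow, abs_neg, abs_one, one_pow, one_mul,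
    Nat.abs_cast, abs_of_pos (by positivity : (0 : ℝ) < 4 ^ n)]
  exact div_le_one_of_le₀ h (by positivity)

theorem abs_besselOneDivCoeff_le (n : ℕ) : |besselOneDivCoeff n| ≤ 1 := by
  have h1 : catalan n ≤ n.centralBinom := by
    rw [← succ_mul_catalan_eq_centralBinom]
    exact Nat.le_mul_of_pos_left _ n.succ_pos
  have h : (catalan n : ℝ) ≤ 4 ^ n := by
    exact_mod_cast h1.trans (Nat.centralBinom_le_four_pow n)
  rw [besselOneDivCoeff, abs_div, abs_mul, abs_pow, abs_neg, abs_one, one_pow, one_mul,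
    Nat.abs_cast, abs_of_pos (by positivity : (0 : ℝ) < 2 * 4 ^ n)]
  refine div_le_one_of_le₀ ?_ (by positivity)
  have : (0 : ℝ) < 4 ^ n := by positivity
  linarith

theorem centralBinom_mul_factorial_sq (n : ℕ) :
    (n.centralBinom : ℝ) * (n.factorial * n.factorial) = (2 * n).factorial := by
  have h := Nat.choose_mul_factorial_mul_factorial (show n ≤ 2 * n by omega)
  rw [show 2 * n - n = n by omega, mul_assoc] at h
  exact_mod_cast h

theorem J0_eq_evenSeries : J0 = evenSeries besselZeroCoeff := by
  funext x
  refine tsum_congr fun n => ?_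
  have h := centralBinom_mul_factorial_sq n
  have h1 : ((2 * n).factorial : ℝ) ≠ 0 := by positivity
  have h2 : (n.factorial : ℝ) ≠ 0 := by positivity
  rw [besselZeroCoeff, div_pow, pow_mul 2 2 n, div_eq_div_iff (by positivity) (by positivity), ← h]
  norm_num
  field_simp

theorem J1_eq_mul_evenSeries (x : ℝ) : J1 x = x * evenSeries besselOneDivCoeff x := by
  rw [J1, evenSeries, ← tsum_mul_left]
  refine tsum_congr fun n => ?_
  have h := centralBinom_mul_factorial_sq n
  have h1 : ((2 * n).factorial : ℝ) ≠ 0 := by positivity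
  have h2 : (n.factorial : ℝ) ≠ 0 := by positivity
  have h3 : ((n : ℝ) + 1) * catalan n = n.centralBinom := by
    exact_mod_cast succ_mul_catalan_eq_centralBinom n
  rw [besselOneDivCoeff, div_pow, pow_succ 2, pow_mul 2 2 n, Nat.factorial_succ, ← mul_div_assoc x,
    div_eq_div_iff (by positivity) (by positivity), ← h, ← h3]
  push_cast
  norm_num
  field_simp
  ring

theorem continuous_J0 : Continuous J0 := by
  rw [J0_eq_evenSeries]
  exact continuous_evenSeries abs_besselZeroCoeff_le

theorem evenSeries_zero (a : ℕ → ℝ) : evenSeries a 0 = a 0 := by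
  rw [evenSeries, tsum_eq_single 0 fun n hn => by simp [hn]]
  simp

theorem J0_zero : J0 0 = 1 := by
  rw [J0_eq_evenSeries, evenSeries_zero]
  simp [besselZeroCoeff]

/-- The convolution square of `J₀` is the sine. -/
theorem integral_J0_mul_J0_sub (x : ℝ) :
    ∫ s in (0 : ℝ)..x, J0 s * J0 (x - s) = Real.sin x := by
  rw [J0_eq_evenSeries,
    integral_evenSeries_mul_evenSeries_sub abs_besselZeroCoeff_le abs_besselZeroCoeff_le,
    ← (Real.hasSum_sin x).tsum_eq]
  refine tsum_congr fun n => ?_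
  congr 2
  have h := sum_antidiagonal_centralBinom_mul n
  have h4 : (4 : ℝ) ^ n ≠ 0 := by positivity
  have h5 : (-1 : ℝ) ^ n = (-1) ^ n / 4 ^ n * ∑ p ∈ antidiagonal n,
      (p.1.centralBinom : ℝ) * p.2.centralBinom := by rw [h]; field_simp
  rw [h5, Finset.mul_sum]
  refine Finset.sum_congr rfl fun p hp => ?_
  rw [← mem_antidiagonal.mp hp, besselZeroCoeff, besselZeroCoeff, pow_add,
    pow_add]
  field_simp

/-- The derivative of `J₀` is minus the convolution of `J₀` with `x ↦ J₁(x)/x`. -/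
theorem hasDerivAt_J0 (x : ℝ) :
    HasDerivAt J0 (-∫ s in (0 : ℝ)..x, J0 s * evenSeries besselOneDivCoeff (x - s)) x := by
  rw [J0_eq_evenSeries]
  refine (hasDerivAt_evenSeries abs_besselZeroCoeff_le x).congr_deriv ?_
  rw [integral_evenSeries_mul_evenSeries_sub abs_besselZeroCoeff_le abs_besselOneDivCoeff_le,
    ← tsum_neg]
  refine tsum_congr fun n => ?_
  rw [← neg_div, ← neg_mul]
  congr 2
  have h := sum_antidiagonal_centralBinom_mul_catalan n
  have h5 : besselZeroCoeff (n + 1) = -((-1) ^ n / (2 * 4 ^ n) *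
      ∑ p ∈ antidiagonal n, (p.1.centralBinom : ℝ) * catalan p.2) := by
    rw [h, besselZeroCoeff]
    ring
  rw [h5, Finset.mul_sum]
  congr 1
  refine Finset.sum_congr rfl fun p hp => ?_
  rw [← mem_antidiagonal.mp hp, besselZeroCoeff, besselOneDivCoeff,
    pow_add,
    pow_add]
  field_simp

/-! ### The first positive zero of `J₀` -/

theorem J0_pos_of_ne_zero {x : ℝ} (hx : 0 ≤ x) (h : ∀ y, 0 < y → y ≤ x → J0 y ≠ 0) :
    0 < J0 x := by
  by_contra! hneg
  obtain ⟨y, hy, hy0⟩ := intermediate_value_Icc' hx continuous_J0.continuousOn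
    (show (0 : ℝ) ∈ Set.Icc (J0 x) (J0 0) from ⟨hneg, by rw [J0_zero]; exact zero_le_one⟩)
  rcases hy.1.eq_or_lt with rfl | hpos
  · rw [J0_zero] at hy0
    exact one_ne_zero hy0
  · exact h y hpos hy.2 hy0

theorem sin_pos_of_J0_pos {x : ℝ} (hx : 0 < x) (h : ∀ y ∈ Set.Ioo 0 x, 0 < J0 y) :
    0 < Real.sin x := by
  rw [← integral_J0_mul_J0_sub]
  have hc := continuous_J0
  refine intervalIntegral.intervalIntegral_pos_of_pos_on
    (Continuous.intervalIntegrable (by fun_prop) _ _) (fun s hs => ?_) hx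
  exact mul_pos (h s hs) (h _ ⟨by linarith [hs.2], by linarith [hs.1]⟩)

theorem exists_J0_zero : ∃ x, 0 < x ∧ J0 x = 0 := by
  by_contra! h
  have := sin_pos_of_J0_pos Real.pi_pos
    fun y hy => J0_pos_of_ne_zero hy.1.le fun z hz _ => h z hz
  simp at this

theorem c0_mem : 0 < c0 ∧ J0 c0 = 0 := by
  have heq : {x : ℝ | 0 < x ∧ J0 x = 0} = {x : ℝ | 0 ≤ x ∧ J0 x = 0} := by
    ext x
    refine ⟨fun h => ⟨h.1.le, h.2⟩, fun h => ⟨h.1.lt_of_ne ?_, h.2⟩⟩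
    rintro rfl
    exact one_ne_zero (J0_zero.symm.trans h.2)
  have hclosed : IsClosed {x : ℝ | 0 < x ∧ J0 x = 0} := by
    rw [heq]
    exact (isClosed_le continuous_const continuous_id).inter
      (isClosed_eq continuous_J0 continuous_const)
  exact hclosed.csInf_mem exists_J0_zero ⟨0, fun x hx => hx.1.le⟩

theorem J0_pos_of_lt_c0 {x : ℝ} (hx : 0 ≤ x) (h : x < c0) : 0 < J0 x :=
  J0_pos_of_ne_zero hx fun _ hy hyx hy0 =>
    notMem_of_lt_csInf (hyx.trans_lt h) ⟨0, fun _ hz => hz.1.le⟩ ⟨hy, hy0⟩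

theorem sin_c0_pos : 0 < Real.sin c0 :=
  sin_pos_of_J0_pos c0_mem.1 fun _ hy => J0_pos_of_lt_c0 hy.1.le hy.2

end Bessel

/-! ### Stationarity for a density built from a renewal-type equation -/

theorem integral_integral_triangle_swap {f : ℝ → ℝ → ℝ} (hf : Continuous f.uncurry) {T : ℝ}
    (hT : 0 ≤ T) :
    ∫ x in (0 : ℝ)..T, ∫ y in (0 : ℝ)..x, f x y = ∫ y in (0 : ℝ)..T, ∫ x in y..T, f x y := by
  have hmeas : MeasurableSet {z : ℝ × ℝ | z.2 < z.1} :=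
    measurableSet_lt measurable_snd measurable_fst
  have hint : IntegrableOn (Function.uncurry fun x y : ℝ =>
      {z : ℝ × ℝ | z.2 < z.1}.indicator f.uncurry (x, y)) (Set.uIoc 0 T ×ˢ Set.uIoc 0 T) := by
    have h : IntegrableOn f.uncurry (Set.uIcc 0 T ×ˢ Set.uIcc 0 T) :=
      hf.continuousOn.integrableOn_compact (isCompact_uIcc.prod isCompact_uIcc)
    exact (h.mono_set (Set.prod_mono Set.uIoc_subset_uIcc Set.uIoc_subset_uIcc)).indicator hmeas
  have hswap := intervalIntegral_intervalIntegral_swap hint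
  convert hswap using 1
  · refine intervalIntegral.integral_congr_Ioo_of_le hT fun x hx => ?_
    have hind : (fun y => {z : ℝ × ℝ | z.2 < z.1}.indicator f.uncurry (x, y)) =
        (Set.Iio x).indicator (f x) := rfl
    have hset : Set.Ioc 0 T ∩ Set.Iio x = Set.Ioo 0 x := by
      ext y
      exact ⟨fun h => ⟨h.1.1, h.2⟩, fun h => ⟨⟨h.1, h.2.le.trans hx.2.le⟩, h.2⟩⟩
    simp only [hind]
    rw [intervalIntegral.integral_of_le hT, setIntegral_indicator measurableSet_Iio, hset,
      intervalIntegral.integral_of_le hx.1.le, integral_Ioc_eq_integral_Ioo]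
  · refine intervalIntegral.integral_congr_Ioo_of_le hT fun y hy => ?_
    have hind : (fun x => {z : ℝ × ℝ | z.2 < z.1}.indicator f.uncurry (x, y)) =
        (Set.Ioi y).indicator (fun x => f x y) := rfl
    have hset : Set.Ioc 0 T ∩ Set.Ioi y = Set.Ioc y T := by
      ext x
      exact ⟨fun h => ⟨h.2, h.1.2⟩, fun h => ⟨⟨hy.1.trans h.1, h.2⟩, h.1⟩⟩
    simp only [hind]
    rw [intervalIntegral.integral_of_le hT, setIntegral_indicator measurableSet_Ioi, hset,
      intervalIntegral.integral_of_le hy.2.le]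

theorem integral_renewal_density_eq_zero {p K φ : ℝ → ℝ} {T : ℝ} (hT : 0 ≤ T)
    (hK : Continuous K)
    (hp : ∀ x, HasDerivAt p (-∫ y in (0 : ℝ)..x, K (x - y) * p y) x)
    (hp0 : ∀ x ∈ Set.Ioo 0 T, p x ≠ 0) (hφ : ContDiff ℝ 1 φ) (hφ0 : φ 0 = 0) (hφT : φ T = 0) :
    ∫ x in (0 : ℝ)..T, p x * p (T - x) *
      (deriv φ x + ∫ y in (0 : ℝ)..x, K (x - y) * (p y / p x) * (φ y - φ x)) = 0 := by
  have hpc : Continuous p := continuous_iff_continuousAt.mpr fun x => (hp x).continuousAt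
  have hφc : Continuous φ := hφ.continuous
  have hφ' : Continuous (deriv φ) := hφ.continuous_deriv le_rfl
  set d : ℝ → ℝ := fun x => -∫ y in (0 : ℝ)..x, K (x - y) * p y with hd
  have hdc : Continuous d := by
    refine Continuous.neg
      (intervalIntegral.continuous_parametric_intervalIntegral_of_continuous ?_ continuous_id)
    simp only [Function.uncurry_def]
    fun_prop
  have hqc : Continuous fun x => ∫ y in (0 : ℝ)..x, K (x - y) * (p y * φ y) := by
    refine intervalIntegral.continuous_parametric_intervalIntegral_of_continuous ?_ continuous_id
    simp only [Function.uncurry_def]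
    fun_prop
  have hexpand : ∫ x in (0 : ℝ)..T, p x * p (T - x) *
      (deriv φ x + ∫ y in (0 : ℝ)..x, K (x - y) * (p y / p x) * (φ y - φ x)) =
      ∫ x in (0 : ℝ)..T, (p (T - x) * (p x * deriv φ x + d x * φ x) +
        p (T - x) * ∫ y in (0 : ℝ)..x, K (x - y) * (p y * φ y)) := by
    refine intervalIntegral.integral_congr_Ioo_of_le hT fun x hx => ?_
    have hpx := hp0 x hx
    have h1 : ∫ y in (0 : ℝ)..x, K (x - y) * (p y / p x) * (φ y - φ x) =
        (p x)⁻¹ * ((∫ y in (0 : ℝ)..x, K (x - y) * (p y * φ y)) -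
          (∫ y in (0 : ℝ)..x, K (x - y) * p y) * φ x) := by
      rw [← intervalIntegral.integral_mul_const, ← intervalIntegral.integral_sub
        (Continuous.intervalIntegrable (by fun_prop) _ _)
        (Continuous.intervalIntegrable (by fun_prop) _ _), ← intervalIntegral.integral_const_mul]
      refine intervalIntegral.integral_congr fun y _ => ?_
      simp only [div_eq_mul_inv]
      ring
    simp only [h1, hd]
    field_simp
    ring
  have hswap : ∫ x in (0 : ℝ)..T, p (T - x) * ∫ y in (0 : ℝ)..x, K (x - y) * (p y * φ y) =
      ∫ y in (0 : ℝ)..T, -d (T - y) * (p y * φ y) := by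
    simp_rw [← intervalIntegral.integral_const_mul]
    rw [integral_integral_triangle_swap (by simp only [Function.uncurry_def]; fun_prop) hT]
    refine intervalIntegral.integral_congr fun y _ => ?_
    have h1 := intervalIntegral.integral_comp_sub_left (a := y) (b := T)
      (fun z => K (T - y - z) * p z) T
    rw [sub_self] at h1
    simp only [hd, neg_neg]
    rw [← h1, ← intervalIntegral.integral_mul_const]
    refine intervalIntegral.integral_congr fun x _ => ?_
    rw [show T - y - (T - x) = x - y by ring]
    ring
  rw [hexpand, intervalIntegral.integral_add (Continuous.intervalIntegrable (by fun_prop) _ _)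
    (Continuous.intervalIntegrable (by fun_prop) _ _), hswap, ← intervalIntegral.integral_add
    (Continuous.intervalIntegrable (by fun_prop) _ _)
    (Continuous.intervalIntegrable (by fun_prop) _ _)]
  have hderiv (x : ℝ) : HasDerivAt (fun x => p (T - x) * (p x * φ x))
      (p (T - x) * (p x * deriv φ x + d x * φ x) + -d (T - x) * (p x * φ x)) x := by
    have h1 : HasDerivAt (fun x => p (T - x)) (-d (T - x)) x := by
      exact (hp (T - x)).comp_const_sub T x
    have h2 : HasDerivAt φ (deriv φ x) x := (hφ.differentiable one_ne_zero x).hasDerivAt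
    refine (h1.fun_mul ((hp x).fun_mul h2)).congr_deriv ?_
    simp only [hd]
    ring
  rw [intervalIntegral.integral_eq_sub_of_hasDerivAt (fun x _ => hderiv x)
    (Continuous.intervalIntegrable (by fun_prop) _ _)]
  simp [hφ0, hφT]

theorem F_eq_evenSeries (θ : ℝ) :
    F θ = (c0 / π) ^ 2 / 2 * evenSeries besselOneDivCoeff (c0 / π * θ) := by
  have hπ := Real.pi_ne_zero
  unfold F
  split_ifs with h
  · rw [h, mul_zero, evenSeries_zero]
    simp [besselOneDivCoeff]
    field_simp
  · rw [J1_eq_mul_evenSeries, show θ * c0 / π = c0 / π * θ by ring]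
    field_simp

theorem Finf_eq (θ : ℝ) : Finf θ = J0 (c0 / π * θ) := by
  rw [Finf]
  congr 1
  ring

theorem continuous_F : Continuous F := by
  rw [funext F_eq_evenSeries]
  have := continuous_evenSeries abs_besselOneDivCoeff_le
  fun_prop

theorem hasDerivAt_Finf (θ : ℝ) :
    HasDerivAt Finf (-∫ α in (0 : ℝ)..θ, 2 * F (θ - α) * Finf α) θ := by
  have h := (hasDerivAt_J0 (c0 / π * θ)).comp θ ((hasDerivAt_id θ).const_mul (c0 / π))
  rw [funext Finf_eq]
  refine h.congr_deriv ?_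
  have h1 := intervalIntegral.smul_integral_comp_mul_left (a := 0) (b := θ)
    (fun s => J0 s * evenSeries besselOneDivCoeff (c0 / π * θ - s)) (c0 / π)
  rw [mul_zero] at h1
  rw [← h1, smul_eq_mul, neg_mul, mul_comm, ← mul_assoc, mul_one,
    ← intervalIntegral.integral_const_mul]
  congr 1
  refine intervalIntegral.integral_congr fun α _ => ?_
  simp only [F_eq_evenSeries, mul_sub]
  ring

theorem Finf_pos {θ : ℝ} (h0 : 0 ≤ θ) (h1 : θ < π) : 0 < Finf θ := by
  have hc := c0_mem.1
  rw [Finf]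
  refine J0_pos_of_lt_c0 (by positivity) ?_
  rw [div_lt_iff₀ Real.pi_pos, mul_comm]
  gcongr

theorem Finf_nonneg {θ : ℝ} (h0 : 0 ≤ θ) (h1 : θ ≤ π) : 0 ≤ Finf θ := by
  rcases h1.eq_or_lt with rfl | h
  · rw [Finf, mul_div_assoc, mul_div_cancel₀ _ Real.pi_ne_zero, c0_mem.2]
  · exact (Finf_pos h0 h).le

theorem integral_Finf_mul_Finf_sub :
    ∫ θ in (0 : ℝ)..π, Finf θ * Finf (π - θ) = π / c0 * Real.sin c0 := by
  have hc := c0_mem.1.ne'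
  have hπ := Real.pi_ne_zero
  have h := intervalIntegral.smul_integral_comp_mul_left (a := 0) (b := π)
    (fun s => J0 s * J0 (c0 - s)) (c0 / π)
  rw [mul_zero, div_mul_cancel₀ _ hπ, integral_J0_mul_J0_sub, smul_eq_mul] at h
  rw [← h, ← mul_assoc, div_mul_div_cancel₀ hc, div_self hπ, one_mul]
  refine intervalIntegral.integral_congr fun θ _ => ?_
  simp only [Finf_eq, mul_sub, div_mul_cancel₀ _ hπ]


/-- Proposition 4.3: `ν̃` is the stationary probability density of the continuous-time
angle process along the spine. -/
theorem nuTilde_stationary_density :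
    (∀ θ ∈ Set.Icc (0 : ℝ) Real.pi, 0 ≤ nuTilde θ) ∧
    (∫ θ in (0:ℝ)..Real.pi, nuTilde θ) = 1 ∧
    (∀ φ : ℝ → ℝ, ContDiff ℝ 1 φ → φ 0 = 0 → φ Real.pi = 0 →
      (∫ θ in (0:ℝ)..Real.pi, nuTilde θ * Lgen φ θ) = 0) := by
  have hsin := sin_c0_pos
  have hc := c0_mem.1
  have hπ := Real.pi_pos
  refine ⟨fun θ hθ => ?_, ?_, fun φ hφ hφ0 hφπ => ?_⟩
  · exact mul_nonneg (mul_nonneg (by positivity) (Finf_nonneg hθ.1 hθ.2))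
      (Finf_nonneg (by linarith [hθ.2]) (by linarith [hθ.1]))
  · simp only [nuTilde, mul_assoc]
    rw [intervalIntegral.integral_const_mul, integral_Finf_mul_Finf_sub]
    field_simp
  · have hF := continuous_F
    have h := integral_renewal_density_eq_zero hπ.le (K := fun x => 2 * F x) (by fun_prop)
      hasDerivAt_Finf (fun x hx => (Finf_pos hx.1.le hx.2).ne') hφ hφ0 hφπ
    have h1 (θ : ℝ) : nuTilde θ * Lgen φ θ =
        c0 / (π * Real.sin c0) * (Finf θ * Finf (π - θ) * Lgen φ θ) := by
      rw [nuTilde]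
      ring
    simp_rw [h1]
    rw [intervalIntegral.integral_const_mul]
    exact mul_eq_zero_of_right _ h
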